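/- arXiv:2203.14924 — 2 statements merged into one kernel-verified Lean document; each statement's English description precedes it below -/
import Mathlib

section
/- For every n with 0 ≤ n ≤ H−1, every x̂ ∈ X̂ and every q ∈ Q with q ∉ F and X̂′_{−ε}(q) ≠ ∅, the worst-case cost-to-go satisfies the one-step lower bound 1 − V^ρ_{n+1}(x̂, q) ≥ (1−δ) · (min_{x̃ ∈ X̂′_{−ε}(q)} (1 − V^ρ_n(x̃, q̄_n(x̃, q)))) · (min_{ŵ∈Ŵ} Σ_{x̃ ∈ X̂′_{−ε}(q)} T̂(x̃ | x̂, ρ_{H−n−1}(x̂, q), ŵ)). -/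
open Finset
open scoped Classical

/-- The set `Q′_ε(x̂′, q)` of DFA states reachable from `q` via the label of some concrete
output that is `ε`-close to the abstract output of `x̂′`. -/
noncomputable def Qprime {X Xh Q Pi Y : Type*} [Fintype Q] [NormedAddCommGroup Y]
    (τ : Q → Pi → Q) (L : Y → Pi) (h : X → Y) (hh : Xh → Y) (ε : ℝ)
    (x' : Xh) (q : Q) : Finset Q :=
  Finset.univ.filter fun q' => ∃ x : X, q' = τ q (L (h x)) ∧ ‖h x - hh x'‖ ≤ ε

/-- The set `X̂′_{−ε}(q)` of abstract states all of whose `ε`-close concrete outputs avoid `F`. -/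
noncomputable def XprimeNeg {X Xh Q Pi Y : Type*} [Fintype Xh] [NormedAddCommGroup Y]
    (τ : Q → Pi → Q) (L : Y → Pi) (h : X → Y) (hh : Xh → Y) (ε : ℝ)
    (F : Finset Q) (q : Q) : Finset Xh :=
  Finset.univ.filter fun xh => ∀ x : X, ‖h x - hh xh‖ ≤ ε → τ q (L (h x)) ∉ F

/-- Worst-case cost-to-go `V^ρ_n` for Player I policy `ρ` against the worst-case adversary,
defined recursively with a given selection `qbar` of maximizers over `Q′_ε`. -/
noncomputable def Vrho {Xh U W Q : Type*} [Fintype Xh] [Nonempty Xh] [Fintype W] [Nonempty W]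
    (δ : ℝ) (That : Xh → U → W → Xh → ℝ) (F : Finset Q)
    (ρ : ℕ → Xh → Q → U) (qbar : ℕ → Xh → Q → Q) (H : ℕ) :
    ℕ → Xh → Q → ℝ
  | 0, _, q => if q ∈ F then 1 else 0
  | n + 1, xh, q =>
      if q ∈ F then 1
      else (1 - δ) * (Finset.univ.sup' Finset.univ_nonempty fun w : W =>
          ∑ x' : Xh, Vrho δ That F ρ qbar H n x' (qbar n x' q)
            * That xh (ρ (H - n - 1) xh q) w x') + δ

/-- The worst-case cost-to-go never exceeds one. -/
theorem Vrho_le_one {Xh U W Q : Type*} [Fintype Xh] [Nonempty Xh] [Fintype W] [Nonempty W]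
    {δ : ℝ} (hδ1 : δ ≤ 1) {That : Xh → U → W → Xh → ℝ}
    (hT0 : ∀ xh u w x', 0 ≤ That xh u w x')
    (hT1 : ∀ xh u w, ∑ x' : Xh, That xh u w x' = 1)
    (F : Finset Q) (ρ : ℕ → Xh → Q → U) (qbar : ℕ → Xh → Q → Q) (H n : ℕ) (xh : Xh) (q : Q) :
    Vrho δ That F ρ qbar H n xh q ≤ 1 := by
  induction n generalizing xh q with
  | zero => rw [Vrho]; split_ifs <;> norm_num
  | succ n ih =>
    rw [Vrho]
    split_ifs
    · exact le_rfl
    have hsup : (Finset.univ.sup' Finset.univ_nonempty fun w : W =>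
        ∑ x' : Xh, Vrho δ That F ρ qbar H n x' (qbar n x' q)
          * That xh (ρ (H - n - 1) xh q) w x') ≤ 1 := by
      refine Finset.sup'_le _ _ fun w _ => ?_
      rw [← hT1 xh (ρ (H - n - 1) xh q) w]
      exact Finset.sum_le_sum fun x' _ => mul_le_of_le_one_left (hT0 _ _ _ _) (ih _ _)
    nlinarith [mul_le_mul_of_nonneg_left hsup (sub_nonneg.2 hδ1)]

/-- One-step lower bound on the complement of the worst-case cost-to-go. -/
theorem complement_value_one_step_lower_bound
    {X Xh U W Q Pi Y : Type*} [Nonempty X] [Fintype Xh] [Nonempty Xh]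
    [Fintype W] [Nonempty W] [Fintype Q] [NormedAddCommGroup Y]
    (τ : Q → Pi → Q) (L : Y → Pi) (h : X → Y) (hh : Xh → Y)
    (ε δ : ℝ) (hε : 0 ≤ ε) (hδ0 : 0 ≤ δ) (hδ1 : δ ≤ 1)
    (That : Xh → U → W → Xh → ℝ)
    (hT0 : ∀ xh u w x', 0 ≤ That xh u w x')
    (hT1 : ∀ xh u w, ∑ x' : Xh, That xh u w x' = 1)
    (F : Finset Q) (H : ℕ)
    (ρ : ℕ → Xh → Q → U) (qbar : ℕ → Xh → Q → Q)
    (hQne : ∀ (x' : Xh) (q : Q), (Qprime τ L h hh ε x' q).Nonempty)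
    (hqbar : ∀ (n : ℕ) (x' : Xh) (q : Q),
      qbar n x' q ∈ Qprime τ L h hh ε x' q ∧
      ∀ q' ∈ Qprime τ L h hh ε x' q,
        Vrho δ That F ρ qbar H n x' q' ≤ Vrho δ That F ρ qbar H n x' (qbar n x' q))
    (n : ℕ) (hn : n + 1 ≤ H) (xh : Xh) (q : Q) (hq : q ∉ F)
    (hXne : (XprimeNeg τ L h hh ε F q).Nonempty) :
    1 - Vrho δ That F ρ qbar H (n + 1) xh q
      ≥ (1 - δ)
        * ((XprimeNeg τ L h hh ε F q).inf' hXne fun x' =>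
            1 - Vrho δ That F ρ qbar H n x' (qbar n x' q))
        * (Finset.univ.inf' Finset.univ_nonempty fun w : W =>
            ∑ x' ∈ XprimeNeg τ L h hh ε F q, That xh (ρ (H - n - 1) xh q) w x') := by
  set S := XprimeNeg τ L h hh ε F q
  set u := ρ (H - n - 1) xh q
  set v : Xh → ℝ := fun x' => Vrho δ That F ρ qbar H n x' (qbar n x' q)
  have hv (x' : Xh) : 0 ≤ 1 - v x' :=
    sub_nonneg.2 (Vrho_le_one hδ1 hT0 hT1 F ρ qbar H n x' _)
  obtain ⟨w, -, hw⟩ := Finset.exists_mem_eq_sup' Finset.univ_nonempty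
    fun w : W => ∑ x' : Xh, v x' * That xh u w x'
  have hV : 1 - Vrho δ That F ρ qbar H (n + 1) xh q
      = (1 - δ) * ∑ x' : Xh, (1 - v x') * That xh u w x' := by
    simp only [sub_mul, one_mul, Finset.sum_sub_distrib, hT1]
    rw [← hw, Vrho, if_neg hq]
    ring
  rw [hV, ge_iff_le, mul_assoc]
  refine mul_le_mul_of_nonneg_left ?_ (sub_nonneg.2 hδ1)
  calc (S.inf' hXne fun x' => 1 - v x')
        * (Finset.univ.inf' Finset.univ_nonempty fun w : W => ∑ x' ∈ S, That xh u w x')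
      ≤ (S.inf' hXne fun x' => 1 - v x') * ∑ x' ∈ S, That xh u w x' :=
        mul_le_mul_of_nonneg_left (Finset.inf'_le _ (Finset.mem_univ w))
          (Finset.le_inf' _ _ fun x' _ => hv x')
    _ ≤ ∑ x' ∈ S, (1 - v x') * That xh u w x' := by
        rw [Finset.mul_sum]
        exact Finset.sum_le_sum fun x' hx' =>
          mul_le_mul_of_nonneg_right (Finset.inf'_le _ hx') (hT0 _ _ _ _)
    _ ≤ ∑ x' : Xh, (1 - v x') * That xh u w x' :=
        Finset.sum_le_sum_of_subset_of_nonneg (Finset.subset_univ _)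
          fun x' _ _ => mul_nonneg (hv x') (hT0 _ _ _ _)
end

section
/- Assume X̂′_{−ε}(q) ≠ ∅ for every q ∈ Q with q ∉ F. Let x̂_0 ∈ X̂ and q̄_0 ∈ Q with q̄_0 ∉ F. Then for every k with 0 ≤ k ≤ H there exists a sequence (x̂_*(z), q_*(z)) for z = 0, …, k with x̂_*(0) = x̂_0, q_*(0) = q̄_0, and for each 1 ≤ z ≤ k: x̂_*(z) ∈ X̂′_{−ε}(q_*(z−1)) and q_*(z) = q̄_{H−z}(x̂_*(z), q_*(z−1)) (so in particular q_*(z) ∉ F), such that 1 − V^ρ_H(x̂_0, q̄_0) ≥ (1−δ)^k · (∏_{z=1}^{k} min_{ŵ∈Ŵ} Σ_{x̃ ∈ X̂′_{−ε}(q_*(z−1))} T̂(x̃ | x̂_*(z−1), ρ_{z−1}(x̂_*(z−1), q_*(z−1)), ŵ)) · (1 − V^ρ_{H−k}(x̂_*(k), q_*(k))). (This is the iterated expansion inequality established in the appendix proof of Theorem 3.8.) -/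
open Finset
open scoped Classical

/-- The complement of the cost-to-go is at least `1 - δ` times the minimal transition mass into
any nonempty set `S`, times its smallest value at the next stage over `S`. -/
theorem exists_mem_one_sub_Vrho_succ_ge {Xh U W Q : Type*} [Fintype Xh] [Nonempty Xh]
    [Fintype W] [Nonempty W]
    {δ : ℝ} (hδ1 : δ ≤ 1) {That : Xh → U → W → Xh → ℝ}
    (hT0 : ∀ xh u w x', 0 ≤ That xh u w x')
    (hT1 : ∀ xh u w, ∑ x' : Xh, That xh u w x' = 1) {F : Finset Q}
    (ρ : ℕ → Xh → Q → U) (qbar : ℕ → Xh → Q → Q) (H n : ℕ) (xh : Xh) {q : Q} (hq : q ∉ F)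
    {S : Finset Xh} (hS : S.Nonempty) :
    ∃ y ∈ S, (1 - δ) * (Finset.univ.inf' Finset.univ_nonempty fun w : W =>
        ∑ x' ∈ S, That xh (ρ (H - n - 1) xh q) w x')
        * (1 - Vrho δ That F ρ qbar H n y (qbar n y q))
      ≤ 1 - Vrho δ That F ρ qbar H (n + 1) xh q := by
  obtain ⟨y, hyS, hy⟩ := S.exists_min_image
    (fun x' => 1 - Vrho δ That F ρ qbar H n x' (qbar n x' q)) hS
  refine ⟨y, hyS, ?_⟩
  have hV (x' : Xh) : 0 ≤ 1 - Vrho δ That F ρ qbar H n x' (qbar n x' q) :=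
    sub_nonneg.2 (Vrho_le_one hδ1 hT0 hT1 F ρ qbar H n x' _)
  obtain ⟨w, -, hw⟩ := Finset.exists_mem_eq_sup' (Finset.univ_nonempty (α := W)) fun w : W =>
    ∑ x' : Xh, Vrho δ That F ρ qbar H n x' (qbar n x' q) * That xh (ρ (H - n - 1) xh q) w x'
  rw [Vrho, if_neg hq, hw]
  set T := That xh (ρ (H - n - 1) xh q)
  set V := fun x' => Vrho δ That F ρ qbar H n x' (qbar n x' q)
  have hmass : (Finset.univ.inf' Finset.univ_nonempty fun w : W => ∑ x' ∈ S, T w x') * (1 - V y)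
      ≤ 1 - ∑ x', V x' * T w x' := calc
    _ ≤ (∑ x' ∈ S, T w x') * (1 - V y) :=
      mul_le_mul_of_nonneg_right (Finset.inf'_le _ (Finset.mem_univ w)) (hV y)
    _ ≤ ∑ x' ∈ S, (1 - V x') * T w x' := by
      rw [Finset.sum_mul]
      refine Finset.sum_le_sum fun x' hx' => ?_
      rw [mul_comm]
      exact mul_le_mul_of_nonneg_right (hy x' hx') (hT0 _ _ _ _)
    _ ≤ ∑ x', (1 - V x') * T w x' :=
      Finset.sum_le_sum_of_subset_of_nonneg (Finset.subset_univ S)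
        fun x' _ _ => mul_nonneg (hV x') (hT0 _ _ _ _)
    _ = 1 - ∑ x', V x' * T w x' := by
      simp only [sub_mul, one_mul, Finset.sum_sub_distrib]
      rw [hT1 xh (ρ (H - n - 1) xh q) w]
  rw [mul_assoc]
  calc
    _ ≤ (1 - δ) * (1 - ∑ x', V x' * T w x') :=
      mul_le_mul_of_nonneg_left hmass (sub_nonneg.2 hδ1)
    _ = _ := by ring

theorem notMem_of_mem_Qprime_of_mem_XprimeNeg {X Xh Q Pi Y : Type*} [Fintype Q] [Fintype Xh]
    [NormedAddCommGroup Y] {τ : Q → Pi → Q} {L : Y → Pi} {h : X → Y} {hh : Xh → Y} {ε : ℝ}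
    {F : Finset Q} {q q' : Q} {x' : Xh} (hx' : x' ∈ XprimeNeg τ L h hh ε F q)
    (hq' : q' ∈ Qprime τ L h hh ε x' q) : q' ∉ F := by
  obtain ⟨x, rfl, hx⟩ := (Finset.mem_filter.1 hq').2
  exact (Finset.mem_filter.1 hx').2 x hx

/-- Iterated expansion inequality from the appendix proof of Theorem 3.8: there exists a
sequence of minimizing abstract states and associated DFA states along which the complement
of the worst-case cost-to-go is bounded below by the product of one-step minimal transition
masses into the safe sets `X̂′_{−ε}`. -/
theorem iterated_expansion_inequality
    {X Xh U W Q Pi Y : Type*} [Nonempty X] [Fintype Xh] [Nonempty Xh]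
    [Fintype W] [Nonempty W] [Fintype Q] [NormedAddCommGroup Y]
    (τ : Q → Pi → Q) (L : Y → Pi) (h : X → Y) (hh : Xh → Y)
    (ε δ : ℝ) (hε : 0 ≤ ε) (hδ0 : 0 ≤ δ) (hδ1 : δ ≤ 1)
    (That : Xh → U → W → Xh → ℝ)
    (hT0 : ∀ xh u w x', 0 ≤ That xh u w x')
    (hT1 : ∀ xh u w, ∑ x' : Xh, That xh u w x' = 1)
    (F : Finset Q) (H : ℕ)
    (ρ : ℕ → Xh → Q → U) (qbar : ℕ → Xh → Q → Q)
    (hQne : ∀ (x' : Xh) (q : Q), (Qprime τ L h hh ε x' q).Nonempty)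
    (hqbar : ∀ (n : ℕ) (x' : Xh) (q : Q),
      qbar n x' q ∈ Qprime τ L h hh ε x' q ∧
      ∀ q' ∈ Qprime τ L h hh ε x' q,
        Vrho δ That F ρ qbar H n x' q' ≤ Vrho δ That F ρ qbar H n x' (qbar n x' q))
    (hXne : ∀ q : Q, q ∉ F → (XprimeNeg τ L h hh ε F q).Nonempty)
    (x0 : Xh) (q0 : Q) (hq0 : q0 ∉ F) :
    ∀ k ≤ H, ∃ (xs : ℕ → Xh) (qs : ℕ → Q),
      xs 0 = x0 ∧ qs 0 = q0 ∧
      (∀ z, 1 ≤ z → z ≤ k →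
        xs z ∈ XprimeNeg τ L h hh ε F (qs (z - 1)) ∧
        qs z = qbar (H - z) (xs z) (qs (z - 1)) ∧
        qs z ∉ F) ∧
      1 - Vrho δ That F ρ qbar H H x0 q0
        ≥ (1 - δ) ^ k
          * (∏ z ∈ Finset.Icc 1 k,
              Finset.univ.inf' Finset.univ_nonempty fun w : W =>
                ∑ x' ∈ XprimeNeg τ L h hh ε F (qs (z - 1)),
                  That (xs (z - 1)) (ρ (z - 1) (xs (z - 1)) (qs (z - 1))) w x')
          * (1 - Vrho δ That F ρ qbar H (H - k) (xs k) (qs k)) := by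
  intro k
  induction k with
  | zero =>
    intro _
    exact ⟨fun _ => x0, fun _ => q0, rfl, rfl, fun z h1 h0 => by omega, by simp⟩
  | succ k ih =>
    intro hk
    obtain ⟨xs, qs, hx0, hq0', hstep, hineq⟩ := ih (by omega)
    have hqk : qs k ∉ F := by
      rcases Nat.eq_zero_or_pos k with rfl | hpos
      · rwa [hq0']
      · exact (hstep k hpos le_rfl).2.2
    obtain ⟨y, hyS, hy⟩ := exists_mem_one_sub_Vrho_succ_ge hδ1 hT0 hT1 ρ qbar H (H - (k + 1))
      (xs k) hqk (hXne _ hqk)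
    rw [show H - (H - (k + 1)) - 1 = k by omega, show H - (k + 1) + 1 = H - k by omega] at hy
    have hxs (z : ℕ) (hz : z ≤ k) : Function.update xs (k + 1) y z = xs z :=
      Function.update_of_ne (by omega) _ _
    have hqs (z : ℕ) (hz : z ≤ k) :
        Function.update qs (k + 1) (qbar (H - (k + 1)) y (qs k)) z = qs z :=
      Function.update_of_ne (by omega) _ _
    refine ⟨Function.update xs (k + 1) y,
      Function.update qs (k + 1) (qbar (H - (k + 1)) y (qs k)), ?_, ?_, ?_, ?_⟩
    · rw [hxs 0 (Nat.zero_le k), hx0]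
    · rw [hqs 0 (Nat.zero_le k), hq0']
    · intro z hz1 hzk
      rw [hqs (z - 1) (by omega)]
      rcases Nat.lt_or_ge k z with hlt | hle
      · obtain rfl : z = k + 1 := by omega
        simp only [Function.update_self, Nat.add_sub_cancel]
        exact ⟨hyS, trivial, notMem_of_mem_Qprime_of_mem_XprimeNeg hyS (hqbar _ _ _).1⟩
      · rw [hxs z hle, hqs z hle]
        exact hstep z hz1 hle
    · rw [Finset.prod_Icc_succ_top (by omega)]
      simp only [Nat.add_sub_cancel, Function.update_self, hxs k le_rfl, hqs k le_rfl]
      rw [Finset.prod_congr rfl fun z hz => by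
        rw [hxs (z - 1) (by grind), hqs (z - 1) (by grind)]]
      refine le_trans ?_ hineq
      have hprod := Finset.prod_nonneg (s := Finset.Icc 1 k)
        (f := fun z => Finset.univ.inf' Finset.univ_nonempty fun w : W =>
          ∑ x' ∈ XprimeNeg τ L h hh ε F (qs (z - 1)),
            That (xs (z - 1)) (ρ (z - 1) (xs (z - 1)) (qs (z - 1))) w x')
        fun z _ => Finset.le_inf' _ _ fun w _ => Finset.sum_nonneg fun x' _ => hT0 _ _ _ _
      refine le_trans (le_of_eq ?_) (mul_le_mul_of_nonneg_left hy
        (mul_nonneg (pow_nonneg (sub_nonneg.2 hδ1) k) hprod))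
      ring
end
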